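/- Let K and K' be half-plane hulls with ∅ ≠ K' ⊂ K, set Ω = ℍ \ K and Ω' = ℍ \ K', and let g : Ω' → ℍ be the inverse of the hydrodynamic conformal map of K'. If Ω is a (β,C₀)-Hölder domain, then g(Ω) = ℍ \ g(K \ K') is a (β/2, C)-Hölder domain, where C > 0 depends only on β, C₀ and diam(K). -/

import Mathlib

open Set Metric Filter Bornology Complex Function

noncomputable section

/-- The upper half-plane as a subset of `ℂ`. -/
def UHP : Set ℂ := {z : ℂ | 0 < z.im}

/-- `K` is a half-plane hull: a bounded subset of the upper half-plane whose
complement in the upper half-plane is a simply connected domain. -/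
def IsHull (K : Set ℂ) : Prop :=
  IsBounded K ∧ K ⊆ UHP ∧ IsOpen (UHP \ K) ∧ IsConnected (UHP \ K) ∧
    SimplyConnectedSpace ↥(UHP \ K)

/-- `f` is the hydrodynamic conformal map of the hull `K`: a conformal bijection
from the upper half-plane onto `UHP \ K` with `f z - z → 0` as `|z| → ∞` in `UHP`. -/
def IsHydroMap (K : Set ℂ) (f : ℂ → ℂ) : Prop :=
  DifferentiableOn ℂ f UHP ∧ InjOn f UHP ∧ f '' UHP = UHP \ K ∧
    Tendsto (fun z => f z - z) (cobounded ℂ ⊓ 𝓟 UHP) (nhds (0 : ℂ))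

/-- `f` is the hydrodynamic map of `K` and `g` is its inverse. -/
def IsHydroPair (K : Set ℂ) (f g : ℂ → ℂ) : Prop :=
  IsHydroMap K f ∧ InvOn g f UHP (UHP \ K)

/-- `K` has half-plane capacity `a`, computed via its hydrodynamic map `f`:
`z * (z - f z) → a` as `|z| → ∞` in `UHP`. -/
def HasHcap (K : Set ℂ) (f : ℂ → ℂ) (a : ℝ) : Prop :=
  Tendsto (fun z => z * (z - f z)) (cobounded ℂ ⊓ 𝓟 UHP) (nhds (a : ℂ))

/-- The `(β, C₀)`-Hölder condition for a map defined on the upper half-plane. -/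
def IsHolder (f : ℂ → ℂ) (β C₀ : ℝ) : Prop :=
  ∀ z ∈ UHP, ∀ z' ∈ UHP, dist (f z) (f z') ≤ C₀ * max (dist z z' ^ β) (dist z z')

/-- The Poincaré hyperbolic distance on the upper half-plane. -/
def rhoH (z w : ℂ) : ℝ :=
  2 * Real.arsinh (dist z w / (2 * Real.sqrt (z.im * w.im)))

/-- The hyperbolic distance on a simply connected domain `Ω`, transported through a
conformal bijection `φ : UHP → Ω` (independent of the choice of `φ`). -/
def rhoVia (φ : ℂ → ℂ) (z w : ℂ) : ℝ :=
  rhoH (invFunOn φ UHP z) (invFunOn φ UHP w)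

/-- `log⁺ x = max (log x) 0`. -/
def posLog (x : ℝ) : ℝ := max (Real.log x) 0

/-- Internal distance between `A` and `B` inside `Ω`: the infimum of diameters of
connected subsets of `Ω` meeting both `A` and `B`. -/
def distIn (Ω A B : Set ℂ) : ℝ :=
  sInf {d : ℝ | ∃ E : Set ℂ, E ⊆ Ω ∧ IsConnected E ∧ (E ∩ A).Nonempty ∧
    (E ∩ B).Nonempty ∧ d = Metric.diam E}

/-- Internal diameter of `A` inside `Ω`. -/
def diamIn (Ω A : Set ℂ) : ℝ :=
  sSup {d : ℝ | ∃ a ∈ A, ∃ b ∈ A, d = distIn Ω {a} {b}}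

/-- An `L`-John curve in `Ω` with tip `z`, parametrized on `[0,1)` (the base-point,
which is not required to lie in `Ω`, corresponds to the missing endpoint). -/
def IsJohnCurve (Ω : Set ℂ) (L : ℝ) (α : ℝ → ℂ) (z : ℂ) : Prop :=
  ContinuousOn α (Ico 0 1) ∧ InjOn α (Ico 0 1) ∧ α 0 = z ∧
    MapsTo α (Ico 0 1) Ω ∧
    ∀ t ∈ Ico (0:ℝ) 1, Metric.diam (α '' Icc 0 t) ≤ L * infDist (α t) (frontier Ω)

/-- An `L`-John curve in `Ω` with tip `z` and base-point `∞`, parametrized on `[0,∞)`. -/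
def IsJohnCurveInfty (Ω : Set ℂ) (L : ℝ) (α : ℝ → ℂ) (z : ℂ) : Prop :=
  ContinuousOn α (Ici 0) ∧ InjOn α (Ici 0) ∧ α 0 = z ∧
    MapsTo α (Ici 0) Ω ∧ Tendsto α atTop (cobounded ℂ) ∧
    ∀ t ∈ Ici (0:ℝ), Metric.diam (α '' Icc 0 t) ≤ L * infDist (α t) (frontier Ω)


open MeasureTheory in
lemma det_complex_smul_one (c : ℂ) : (c • (1 : ℂ →L[ℝ] ℂ)).det = ‖c‖ ^ 2 := by
  have : ((c • (1 : ℂ →L[ℝ] ℂ) : ℂ →L[ℝ] ℂ) : ℂ →ₗ[ℝ] ℂ) = LinearMap.mulLeft ℝ c := by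
    ext; simp
  rw [ContinuousLinearMap.det, this]
  have h2 : LinearMap.det (LinearMap.mulLeft ℝ c) = Algebra.norm ℝ c := rfl
  rw [h2, Algebra.norm_complex_apply, Complex.normSq_eq_norm_sq]

open MeasureTheory in
lemma logarea_change (S S' : ℂ → ℂ) (s : Set ℂ) (hs : MeasurableSet s)
    (hd : ∀ z ∈ s, HasDerivAt S (S' z) z) (hi : InjOn S s) :
    ∫⁻ w in S '' s, ENNReal.ofReal (1 / ‖w‖ ^ 2) =
      ∫⁻ z in s, ENNReal.ofReal (‖S' z / S z‖ ^ 2) := by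
  rw [lintegral_image_eq_lintegral_abs_det_fderiv_mul volume hs
    (fun z hz => ((hd z hz).complexToReal_fderiv).hasFDerivWithinAt) hi]
  refine setLIntegral_congr_fun hs fun z hz => ?_
  simp only [det_complex_smul_one]
  rw [← ENNReal.ofReal_mul (by positivity), abs_of_nonneg (by positivity)]
  congr 1
  rw [norm_div, div_pow]; ring

open MeasureTheory in
lemma polar_annulus (F : ℂ → ℝ) {a b : ℝ} (ha : 0 ≤ a)
    (hF : ContinuousOn F {z | a < ‖z‖ ∧ ‖z‖ < b}) :
    ∫⁻ z in {z : ℂ | a < ‖z‖ ∧ ‖z‖ < b}, ENNReal.ofReal (F z) =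
      ∫⁻ r in Ioo a b, ∫⁻ θ in Ioo (-Real.pi) Real.pi,
        ENNReal.ofReal r * ENNReal.ofReal (F (r * (Real.cos θ + Real.sin θ * I))) := by
  have hms : MeasurableSet {z : ℂ | a < ‖z‖ ∧ ‖z‖ < b} := by
    apply IsOpen.measurableSet
    exact (isOpen_lt continuous_const continuous_norm).inter
      (isOpen_lt continuous_norm continuous_const)
  rw [← lintegral_indicator hms, ← Complex.lintegral_comp_polarCoord_symm]
  have hnorm : ∀ r θ : ℝ, 0 < r → ‖(r * (Real.cos θ + Real.sin θ * I) : ℂ)‖ = r := by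
    intro r θ hr
    have := Complex.norm_polarCoord_symm (r, θ)
    rw [Complex.polarCoord_symm_apply] at this
    simpa [abs_of_pos hr] using this
  have hms2 : MeasurableSet (Ioo a b ×ˢ Ioo (-Real.pi) Real.pi) :=
    measurableSet_Ioo.prod measurableSet_Ioo
  have key : ∫⁻ p in polarCoord.target, ENNReal.ofReal p.1 •
      {z : ℂ | a < ‖z‖ ∧ ‖z‖ < b}.indicator (fun z => ENNReal.ofReal (F z))
        (Complex.polarCoord.symm p) =
      ∫⁻ p in Ioo a b ×ˢ Ioo (-Real.pi) Real.pi, ENNReal.ofReal p.1 *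
        ENNReal.ofReal (F (p.1 * (Real.cos p.2 + Real.sin p.2 * I))) := by
    rw [← lintegral_indicator hms2, ← lintegral_indicator polarCoord.open_target.measurableSet]
    congr 1
    ext ⟨r, θ⟩
    simp only [indicator, polarCoord_target, mem_prod, mem_Ioi, mem_Ioo, mem_ofPred_eq,
      Complex.polarCoord_symm_apply, smul_eq_mul]
    by_cases hr : 0 < r
    · simp only [hr, hnorm r θ hr, true_and]
      by_cases h1 : -Real.pi < θ ∧ θ < Real.pi <;> by_cases h2 : a < r ∧ r < b <;> simp [h1, h2]
    · have : ¬ (a < r) := fun h => hr (ha.trans_lt h)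
      simp [hr, this]
  rw [key, Measure.volume_eq_prod, ← Measure.prod_restrict, lintegral_prod]
  rw [Measure.prod_restrict, ← Measure.volume_eq_prod]
  apply AEMeasurable.fun_mul
  · fun_prop
  · apply AEMeasurable.ennreal_ofReal
    apply ContinuousOn.aemeasurable _ hms2
    apply hF.comp (t := {z | a < ‖z‖ ∧ ‖z‖ < b})
    · fun_prop
    · rintro ⟨r, θ⟩ ⟨h1, h2⟩
      simp only [mem_Ioo, mem_ofPred_eq] at *
      rw [hnorm r θ (ha.trans_lt h1.1)]
      exact h1

open MeasureTheory in
lemma lintegral_inv_Ioo {a b c : ℝ} (ha : 0 < a) (hab : a ≤ b) (hc : 0 ≤ c) :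
    ∫⁻ r in Ioo a b, ENNReal.ofReal (c / r) = ENNReal.ofReal (c * Real.log (b / a)) := by
  have h0 : (0:ℝ) ∉ uIcc a b := by
    rw [uIcc_of_le hab]; intro h; exact absurd h.1 (not_le.2 ha)
  have hintv : IntervalIntegrable (fun r : ℝ => c / r) volume a b := by
    apply ContinuousOn.intervalIntegrable
    intro x hx
    have : x ≠ 0 := fun h => h0 (h ▸ hx)
    exact (continuousAt_const.div continuousAt_id this).continuousWithinAt
  rw [← ofReal_integral_eq_lintegral_ofReal]
  · rw [← integral_Ioc_eq_integral_Ioo, ← intervalIntegral.integral_of_le hab]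
    simp_rw [div_eq_mul_inv c]
    rw [intervalIntegral.integral_const_mul, integral_inv h0]
  · exact ((intervalIntegrable_iff_integrableOn_Ioc_of_le hab).1 hintv).mono_set Ioo_subset_Ioc_self
  · refine (ae_restrict_mem measurableSet_Ioo).mono fun x hx => ?_
    have := ha.trans hx.1
    simp only [Pi.zero_apply]; positivity

open MeasureTheory in
lemma logarea_annulus {a b : ℝ} (ha : 0 < a) (hab : a ≤ b) :
    ∫⁻ z in {z : ℂ | a < ‖z‖ ∧ ‖z‖ < b}, ENNReal.ofReal (1 / ‖z‖ ^ 2) =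
      ENNReal.ofReal (2 * Real.pi * Real.log (b / a)) := by
  rw [polar_annulus (fun z => 1 / ‖z‖ ^ 2) ha.le, ← lintegral_inv_Ioo ha hab (by positivity)]
  · refine setLIntegral_congr_fun measurableSet_Ioo fun r hr => ?_
    have hr0 : 0 < r := ha.trans hr.1
    have hnorm : ∀ θ : ℝ, ‖(r * (Real.cos θ + Real.sin θ * I) : ℂ)‖ = r := by
      intro θ
      have := Complex.norm_polarCoord_symm (r, θ)
      rw [Complex.polarCoord_symm_apply] at this
      simpa [abs_of_pos hr0] using this
    simp only [hnorm]
    rw [lintegral_const, ← ENNReal.ofReal_mul hr0.le, Measure.restrict_apply_univ, Real.volume_Ioo,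
      ← ENNReal.ofReal_mul (by positivity)]
    congr 1
    field_simp
    ring
  · intro z hz
    have : ‖z‖ ^ 2 ≠ 0 := by have := ha.trans hz.1; positivity
    have hc : ContinuousAt (fun z : ℂ => ‖z‖ ^ 2) z := by fun_prop
    exact (continuousAt_const.div hc this).continuousWithinAt


open MeasureTheory in
lemma circle_lower (G : ℂ → ℂ) (hG : DifferentiableOn ℂ G (ball 0 1)) (h0 : G 0 = 1)
    {r : ℝ} (hr0 : 0 < r) (hr1 : r < 1) :
    ENNReal.ofReal (2 * Real.pi) ≤ ∫⁻ θ in Ioo (-Real.pi) Real.pi,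
      ENNReal.ofReal (‖G (r * (Real.cos θ + Real.sin θ * I))‖ ^ 2) := by
  have hmap : ∀ θ : ℝ, (r * (Real.cos θ + Real.sin θ * I) : ℂ) = circleMap 0 r θ := by
    intro θ
    simp [circleMap, Complex.exp_mul_I]
  simp only [hmap]
  have hsub : closedBall (0:ℂ) r ⊆ ball 0 1 := closedBall_subset_ball hr1
  have hmem : ∀ θ : ℝ, circleMap 0 r θ ∈ ball (0:ℂ) 1 := fun θ =>
    hsub (circleMap_mem_closedBall 0 hr0.le θ)
  have hu : Continuous fun θ : ℝ => G (circleMap 0 r θ) :=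
    hG.continuousOn.comp_continuous (continuous_circleMap 0 r) hmem
  have hre : Continuous fun θ : ℝ => (G (circleMap 0 r θ)).re := Complex.continuous_re.comp hu
  have hno : Continuous fun θ : ℝ => ‖G (circleMap 0 r θ)‖ ^ 2 := hu.norm.pow 2
  have havg : Real.circleAverage G 0 r = 1 := by
    rw [← h0]
    apply DiffContOnCl.circleAverage
    rw [abs_of_pos hr0]
    apply DifferentiableOn.diffContOnCl
    rw [closure_ball _ hr0.ne']
    exact hG.mono hsub
  have hper : Periodic (fun θ : ℝ => G (circleMap 0 r θ)) (2 * Real.pi) := by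
    intro θ
    simp only [periodic_circleMap 0 r θ]
  have hI : ∫ θ in (-Real.pi)..Real.pi, G (circleMap 0 r θ) = 2 * Real.pi := by
    have h1 := hper.intervalIntegral_add_eq (-Real.pi) 0
    have e : -Real.pi + 2 * Real.pi = Real.pi := by ring
    rw [e, zero_add] at h1
    rw [h1]
    rw [Real.circleAverage_def] at havg
    have hpi : (2 * Real.pi : ℝ) ≠ 0 := by positivity
    have := congrArg (fun z : ℂ => (2 * Real.pi : ℝ) • z) havg
    simp only [smul_smul, mul_inv_cancel₀ hpi, one_smul] at this
    rw [this]; simp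
  have hle : -Real.pi ≤ Real.pi := by linarith [Real.pi_pos]
  have hRe : ∫ θ in (-Real.pi)..Real.pi, (G (circleMap 0 r θ)).re = 2 * Real.pi := by
    have := congrArg Complex.re hI
    have h2 := (Complex.reCLM).intervalIntegral_comp_comm (μ := volume) (a := -Real.pi) (b := Real.pi)
      (hu.intervalIntegrable _ _)
    simp only [Complex.reCLM_apply] at h2
    rw [h2, this]; simp
  have hlow : 2 * Real.pi ≤ ∫ θ in (-Real.pi)..Real.pi, ‖G (circleMap 0 r θ)‖ ^ 2 := by
    have h3 : ∫ θ in (-Real.pi)..Real.pi, (2 * (G (circleMap 0 r θ)).re - 1) = 2 * Real.pi := by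
      rw [intervalIntegral.integral_sub, intervalIntegral.integral_const_mul, hRe]
      · simp; ring
      · exact (continuous_const.mul hre).intervalIntegrable _ _
      · exact continuous_const.intervalIntegrable _ _
    rw [← h3]
    apply intervalIntegral.integral_mono_on hle
    · exact ((continuous_const.mul hre).sub continuous_const).intervalIntegrable _ _
    · exact hno.intervalIntegrable _ _
    · intro θ _
      rw [← Complex.normSq_eq_norm_sq, Complex.normSq_apply]
      nlinarith [sq_nonneg ((G (circleMap 0 r θ)).re - 1), sq_nonneg (G (circleMap 0 r θ)).im]
  rw [← ofReal_integral_eq_lintegral_ofReal]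
  · apply ENNReal.ofReal_le_ofReal
    rwa [← integral_Ioc_eq_integral_Ioo, ← intervalIntegral.integral_of_le hle]
  · exact (hno.integrableOn_Icc).mono_set Ioo_subset_Icc_self
  · exact ae_of_all _ fun x => by simp only [Pi.zero_apply]; positivity

open MeasureTheory in
lemma logarea_lower (T : ℂ → ℂ) (hT : DifferentiableOn ℂ T (ball 0 1))
    (hinj : InjOn T (ball 0 1)) (h0 : T 0 = 0) (hd : deriv T 0 ≠ 0) {ρ : ℝ} (hρ0 : 0 < ρ)
    (hρ1 : ρ < 1) :
    ENNReal.ofReal (2 * Real.pi * Real.log (1 / ρ)) ≤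
      ∫⁻ z in {z : ℂ | ρ < ‖z‖ ∧ ‖z‖ < 1}, ENNReal.ofReal (‖deriv T z / T z‖ ^ 2) := by
  have hk : DifferentiableOn ℂ (dslope T 0) (ball 0 1) :=
    (differentiableOn_dslope (ball_mem_nhds _ one_pos)).2 hT
  have hTne : ∀ z ∈ ball (0:ℂ) 1, z ≠ 0 → T z ≠ 0 := by
    intro z hz hz0 h
    exact hz0 (hinj hz (mem_ball_self one_pos) (h.trans h0.symm))
  have hkz : ∀ z : ℂ, z ≠ 0 → dslope T 0 z = T z / z := by
    intro z hz
    rw [dslope_of_ne _ hz, slope_def_field, h0]; simp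
  have hkne : ∀ z ∈ ball (0:ℂ) 1, dslope T 0 z ≠ 0 := by
    intro z hz
    by_cases hz0 : z = 0
    · rw [hz0, dslope_same]; exact hd
    · rw [hkz z hz0]; exact div_ne_zero (hTne z hz hz0) hz0
  have hG : DifferentiableOn ℂ (fun z => deriv T z / dslope T 0 z) (ball 0 1) :=
    (hT.deriv isOpen_ball).div hk hkne
  have hsub : {z : ℂ | ρ < ‖z‖ ∧ ‖z‖ < 1} ⊆ ball 0 1 := fun z hz => by simpa using hz.2
  have hcont : ContinuousOn (fun z => ‖deriv T z / T z‖ ^ 2) {z : ℂ | ρ < ‖z‖ ∧ ‖z‖ < 1} := by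
    apply ContinuousOn.pow
    apply ContinuousOn.norm
    apply ContinuousOn.div ((hT.deriv isOpen_ball).continuousOn.mono hsub)
      (hT.continuousOn.mono hsub)
    intro z hz
    refine hTne z (hsub hz) ?_
    intro h; have := hz.1; rw [h, norm_zero] at this; linarith
  rw [polar_annulus _ hρ0.le hcont, ← lintegral_inv_Ioo hρ0 hρ1.le (by positivity)]
  apply setLIntegral_mono' measurableSet_Ioo
  intro r hr
  have hr0 : 0 < r := hρ0.trans hr.1
  have hnorm : ∀ θ : ℝ, ‖(r * (Real.cos θ + Real.sin θ * I) : ℂ)‖ = r := by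
    intro θ
    have := Complex.norm_polarCoord_symm (r, θ)
    rw [Complex.polarCoord_symm_apply] at this
    simpa [abs_of_pos hr0] using this
  have hcl := circle_lower _ hG (by simp [dslope_same, hd]) hr0 hr.2
  have heq : ∀ θ : ℝ, ENNReal.ofReal r *
      ENNReal.ofReal (‖deriv T (r * (Real.cos θ + Real.sin θ * I)) /
        T (r * (Real.cos θ + Real.sin θ * I))‖ ^ 2) = ENNReal.ofReal (1 / r) *
      ENNReal.ofReal (‖deriv T (r * (Real.cos θ + Real.sin θ * I)) /
        dslope T 0 (r * (Real.cos θ + Real.sin θ * I))‖ ^ 2) := by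
    intro θ
    rw [← ENNReal.ofReal_mul hr0.le, ← ENNReal.ofReal_mul (by positivity)]
    congr 1
    have hn := hnorm θ
    set z : ℂ := r * (Real.cos θ + Real.sin θ * I) with hz
    have hz0 : z ≠ 0 := by intro h; rw [h, norm_zero] at hn; linarith
    rw [hkz z hz0]
    simp only [norm_div, hn]
    field_simp
  simp only [heq]
  rw [lintegral_const_mul' _ _ ENNReal.ofReal_ne_top]
  calc ENNReal.ofReal (2 * Real.pi / r) = ENNReal.ofReal (1 / r) * ENNReal.ofReal (2 * Real.pi) := by
        rw [← ENNReal.ofReal_mul (by positivity)]; congr 1; ring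
    _ ≤ _ := by gcongr


open MeasureTheory in
/-- A univalent Bieberbach–Eilenberg function has derivative at most one at the origin. -/
lemma be_bound (T : ℂ → ℂ) (hT : DifferentiableOn ℂ T (ball 0 1))
    (hinj : InjOn T (ball 0 1)) (h0 : T 0 = 0)
    (hTT : ∀ z ∈ ball (0:ℂ) 1, ∀ w ∈ ball (0:ℂ) 1, T z * T w ≠ 1) : ‖deriv T 0‖ ≤ 1 := by
  by_contra hcon
  push Not at hcon
  obtain ⟨b, hb1, hba⟩ := exists_between hcon
  have hd : deriv T 0 ≠ 0 := by intro h; rw [h, norm_zero] at hcon; linarith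
  have hTat : ∀ z ∈ ball (0:ℂ) 1, HasDerivAt T (deriv T z) z := fun z hz =>
    (hT.differentiableAt (isOpen_ball.mem_nhds hz)).hasDerivAt
  have h0m : (0:ℂ) ∈ ball (0:ℂ) 1 := mem_ball_self one_pos
  have hTne : ∀ z ∈ ball (0:ℂ) 1, z ≠ 0 → T z ≠ 0 := by
    intro z hz hz0 h
    exact hz0 (hinj hz h0m (h.trans h0.symm))
  -- near the origin
  have hk : ContinuousAt (dslope T 0) 0 :=
    continuousAt_dslope_same.2 (hTat 0 h0m).differentiableAt
  have hev : ∀ᶠ z in nhds (0:ℂ), b < ‖dslope T 0 z‖ := by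
    apply hk.norm.eventually_const_lt
    simpa [dslope_same] using hba
  obtain ⟨ε, hε0, hε⟩ := Metric.eventually_nhds_iff_ball.1
    (hev.and (isOpen_ball.mem_nhds h0m))
  have hεz : ∀ z ∈ ball (0:ℂ) ε, b * ‖z‖ ≤ ‖T z‖ := by
    intro z hz
    by_cases hz0 : z = 0
    · simp [hz0, h0]
    · have h1 := (hε z hz).1
      rw [dslope_of_ne _ hz0, slope_def_field, h0, sub_zero, sub_zero, norm_div] at h1
      exact ((lt_div_iff₀ (norm_pos_iff.2 hz0)).1 h1).le
  have hst : HasStrictDerivAt T (deriv T 0) 0 := by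
    have han : AnalyticAt ℂ T 0 := hT.analyticAt (isOpen_ball.mem_nhds h0m)
    exact han.hasStrictDerivAt
  have hmap := hst.map_nhds_eq hd
  have himg : T '' ball 0 ε ∈ nhds (0:ℂ) := by
    have h1 : T '' ball 0 ε ∈ map T (nhds 0) := image_mem_map (ball_mem_nhds _ hε0)
    rwa [hmap, h0] at h1
  obtain ⟨η, hη0, hη⟩ := Metric.mem_nhds_iff.1 himg
  have hηz : ∀ z ∈ ball (0:ℂ) 1, ‖T z‖ < η → z ∈ ball (0:ℂ) ε := by
    intro z hz hzη
    obtain ⟨z', hz', he⟩ := hη (show T z ∈ ball (0:ℂ) η by simpa using hzη)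
    rwa [← hinj (hε z' hz').2 hz he]
  have hb0 : 0 < b := by linarith
  obtain ⟨ρ, hρ0, hρ⟩ : ∃ ρ : ℝ, 0 < ρ ∧ ρ < min (min 1 (1 / b)) (η / b) :=
    exists_between (by positivity)
  have hρ1 : ρ < 1 := hρ.trans_le ((min_le_left _ _).trans (min_le_left _ _))
  have hm1 : b * ρ < 1 := by
    have := hρ.trans_le ((min_le_left _ _).trans (min_le_right _ _))
    rw [lt_div_iff₀ hb0] at this; linarith
  have hmη : b * ρ < η := by
    have := hρ.trans_le (min_le_right _ _)
    rw [lt_div_iff₀ hb0] at this; linarith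
  set m := b * ρ with hm
  have hm0 : 0 < m := by positivity
  set A : Set ℂ := {z : ℂ | ρ < ‖z‖ ∧ ‖z‖ < 1} with hA
  have hAsub : A ⊆ ball 0 1 := fun z hz => by simpa using hz.2
  have hAne : ∀ z ∈ A, T z ≠ 0 := by
    intro z hz
    refine hTne z (hAsub hz) ?_
    intro h; have := hz.1; rw [h, norm_zero] at this; linarith
  have hlow : ∀ z ∈ A, m < ‖T z‖ := by
    intro z hz
    by_cases h : ‖T z‖ < η
    · have := hεz z (hηz z (hAsub hz) h)
      have h2 : b * ρ < b * ‖z‖ := mul_lt_mul_of_pos_left hz.1 hb0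
      linarith
    · linarith
  have hupp : ∀ z ∈ A, ‖T z‖ < 1 / m := by
    intro z hz
    by_contra h
    push Not at h
    have h1 : ‖(T z)⁻¹‖ < η := by
      rw [norm_inv]
      have : ‖T z‖⁻¹ ≤ m := by
        rw [inv_le_comm₀ (norm_pos_iff.2 (hAne z hz)) hm0, ← one_div]; exact h
      linarith
    obtain ⟨w, hw, he⟩ := hη (show (T z)⁻¹ ∈ ball (0:ℂ) η by simpa using h1)
    apply hTT z (hAsub hz) w (hε w hw).2
    rw [he, mul_inv_cancel₀ (hAne z hz)]
  have hAo : IsOpen A := (isOpen_lt continuous_const continuous_norm).inter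
      (isOpen_lt continuous_norm continuous_const)
  have hAm : MeasurableSet A := hAo.measurableSet
  have hTA : ∀ z ∈ A, HasDerivAt T (deriv T z) z := fun z hz => hTat z (hAsub hz)
  have hSA : ∀ z ∈ A, HasDerivAt (fun z => (T z)⁻¹) (-deriv T z / T z ^ 2) z := fun z hz =>
    (hTA z hz).fun_inv (hAne z hz)
  have hiT : InjOn T A := hinj.mono hAsub
  have hiS : InjOn (fun z => (T z)⁻¹) A := fun z hz w hw h => hiT hz hw (inv_injective h)
  have e1 := logarea_change T (deriv T) A hAm hTA hiT
  have e2 := logarea_change (fun z => (T z)⁻¹) (fun z => -deriv T z / T z ^ 2) A hAm hSA hiS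
  have e3 : ∫⁻ z in A, ENNReal.ofReal (‖(-deriv T z / T z ^ 2) / (T z)⁻¹‖ ^ 2) =
      ∫⁻ z in A, ENNReal.ofReal (‖deriv T z / T z‖ ^ 2) := by
    refine setLIntegral_congr_fun hAm fun z hz => ?_
    have := hAne z hz
    have e : (-deriv T z / T z ^ 2) / (T z)⁻¹ = -(deriv T z / T z) := by field_simp
    simp only [e, norm_neg]
  have hdis : Disjoint (T '' A) ((fun z => (T z)⁻¹) '' A) := by
    rw [Set.disjoint_left]
    rintro _ ⟨z, hz, rfl⟩ ⟨w, hw, he⟩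
    apply hTT z (hAsub hz) w (hAsub hw)
    simp only at he
    rw [← he, inv_mul_cancel₀ (hAne w hw)]
  have hms : MeasurableSet ((fun z => (T z)⁻¹) '' A) :=
    measurable_image_of_fderivWithin hAm
      (fun z hz => ((hSA z hz).complexToReal_fderiv).hasFDerivWithinAt) hiS
  have hun := lintegral_union (μ := volume) (f := fun w : ℂ => ENNReal.ofReal (1 / ‖w‖ ^ 2)) hms hdis
  have hsubann : T '' A ∪ (fun z => (T z)⁻¹) '' A ⊆ {z : ℂ | m < ‖z‖ ∧ ‖z‖ < 1 / m} := by
    rintro _ (⟨z, hz, rfl⟩ | ⟨z, hz, rfl⟩)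
    · exact ⟨hlow z hz, hupp z hz⟩
    · have hp := norm_pos_iff.2 (hAne z hz)
      constructor
      · simp only [norm_inv]
        rw [lt_inv_comm₀ hm0 hp, ← one_div]; exact hupp z hz
      · simp only [norm_inv, one_div]
        exact (inv_lt_inv₀ hp hm0).2 (hlow z hz)
  have hle := lintegral_mono_set (μ := volume) (f := fun w : ℂ => ENNReal.ofReal (1 / ‖w‖ ^ 2)) hsubann
  have hm1' : m ≤ 1 / m := by
    rw [le_div_iff₀ hm0]; nlinarith
  rw [hun, e1, e2, e3, logarea_annulus hm0 hm1'] at hle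
  have hl := logarea_lower T hT hinj h0 hd hρ0 hρ1
  have hfin := (add_le_add hl hl).trans hle
  have hlogρ : 0 ≤ Real.log (1 / ρ) := Real.log_nonneg (by rw [le_div_iff₀ hρ0]; linarith)
  rw [← ENNReal.ofReal_add (by positivity) (by positivity), ENNReal.ofReal_le_ofReal_iff] at hfin
  · have e5 : Real.log (1 / m / m) = 2 * Real.log (1 / m) := by
      rw [div_div, one_div, one_div, Real.log_inv, Real.log_inv, Real.log_mul hm0.ne' hm0.ne']; ring
    rw [e5] at hfin
    have h6 : Real.log (1 / ρ) ≤ Real.log (1 / m) := by nlinarith [Real.pi_pos]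
    rw [Real.log_le_log_iff (by positivity) (by positivity), one_div, one_div,
      inv_le_inv₀ hρ0 hm0] at h6
    nlinarith
  · have : 0 ≤ Real.log (1 / m / m) := Real.log_nonneg (by rw [le_div_iff₀ hm0]; linarith)
    positivity


/-- Koebe one-quarter theorem for a non-vanishing univalent function on the disc. -/
lemma koebe_disc (φ : ℂ → ℂ) (hφ : DifferentiableOn ℂ φ (ball 0 1)) (hinj : InjOn φ (ball 0 1))
    (hne : ∀ z ∈ ball (0:ℂ) 1, φ z ≠ 0) : ‖deriv φ 0‖ ≤ 4 * ‖φ 0‖ := by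
  have h0m : (0:ℂ) ∈ ball (0:ℂ) 1 := mem_ball_self one_pos
  have hφat : ∀ z ∈ ball (0:ℂ) 1, HasDerivAt φ (deriv φ z) z := fun z hz =>
    (hφ.differentiableAt (isOpen_ball.mem_nhds hz)).hasDerivAt
  have hq : DifferentiableOn ℂ (fun z => deriv φ z / φ z) (ball 0 1) :=
    (hφ.deriv isOpen_ball).div hφ hne
  obtain ⟨L, hL0, hL⟩ := hq.isExactOn_ball.with_val_at 0 0
  have hconst : ∀ z ∈ ball (0:ℂ) 1, φ z * exp (-L z) = φ 0 := by
    have hder : ∀ z ∈ ball (0:ℂ) 1, HasDerivAt (fun z => φ z * exp (-L z)) 0 z := by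
      intro z hz
      have h1 := (hφat z hz).mul ((hL z hz).neg.cexp)
      have hz0 := hne z hz
      refine HasDerivAt.congr_deriv h1 ?_
      field_simp
      ring
    intro z hz
    have h2 := isOpen_ball.is_const_of_deriv_eq_zero (convex_ball (0:ℂ) 1).isPreconnected
      (fun z hz => (hder z hz).differentiableAt.differentiableWithinAt)
      (fun z hz => (hder z hz).deriv) hz h0m
    simpa [hL0] using h2
  have hφe : ∀ z ∈ ball (0:ℂ) 1, φ z = φ 0 * exp (L z) := by
    intro z hz
    rw [← hconst z hz, mul_assoc, ← exp_add]; simp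
  set q : ℂ → ℂ := fun z => exp (L z / 2) with hqdef
  have hqsq : ∀ z ∈ ball (0:ℂ) 1, φ z = φ 0 * q z ^ 2 := by
    intro z hz
    rw [hφe z hz, hqdef]; simp only [← exp_nat_mul]; congr 2; push_cast; ring
  have hqne : ∀ z, q z ≠ 0 := fun z => exp_ne_zero _
  have hq0 : q 0 = 1 := by simp [hqdef, hL0]
  have hqq : ∀ z ∈ ball (0:ℂ) 1, ∀ w ∈ ball (0:ℂ) 1, q z + q w ≠ 0 := by
    intro z hz w hw h
    have h1 : q z = - q w := eq_neg_of_add_eq_zero_left h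
    have h2 : φ z = φ w := by rw [hqsq z hz, hqsq w hw, h1]; ring
    have h3 := hinj hz hw h2
    rw [h3] at h1
    have : q w = 0 := by linear_combination h1 / 2
    exact hqne w this
  have hq1 : ∀ z ∈ ball (0:ℂ) 1, q z + 1 ≠ 0 := by
    intro z hz; have := hqq z hz 0 h0m; rwa [hq0] at this
  have hqat : ∀ z ∈ ball (0:ℂ) 1, HasDerivAt q (q z * (deriv φ z / φ z / 2)) z := by
    intro z hz
    exact ((hL z hz).div_const 2).cexp
  set T : ℂ → ℂ := fun z => (q z - 1) / (q z + 1) with hTdef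
  have hTat : ∀ z ∈ ball (0:ℂ) 1, DifferentiableAt ℂ T z := by
    intro z hz
    have := (hqat z hz).differentiableAt
    exact (this.sub_const 1).div (this.add_const 1) (hq1 z hz)
  have hTinj : InjOn T (ball 0 1) := by
    intro z hz w hw h
    simp only [hTdef] at h
    rw [div_eq_div_iff (hq1 z hz) (hq1 w hw)] at h
    have h1 : q z = q w := by linear_combination h / 2
    exact hinj hz hw (by rw [hqsq z hz, hqsq w hw, h1])
  have hbe := be_bound T (fun z hz => (hTat z hz).differentiableWithinAt) hTinj
    (by simp [hTdef, hq0]) (by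
      intro z hz w hw h
      simp only [hTdef] at h
      rw [div_mul_div_comm, div_eq_one_iff_eq (mul_ne_zero (hq1 z hz) (hq1 w hw))] at h
      apply hqq z hz w hw
      linear_combination -h / 2)
  have hder : HasDerivAt T (deriv φ 0 / (4 * φ 0)) 0 := by
    have h1 := ((hqat 0 h0m).sub_const 1).div ((hqat 0 h0m).add_const 1) (hq1 0 h0m)
    refine HasDerivAt.congr_deriv h1 ?_
    rw [hq0]; have := hne 0 h0m; field_simp; ring
  rw [hder.deriv, norm_div, norm_mul] at hbe
  have hp := norm_pos_iff.2 (hne 0 h0m)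
  rw [div_le_one (by simp; exact hne 0 h0m)] at hbe
  simpa using hbe

/-- Conformal map of the disc onto the upper half-plane sending `0` to `z`. -/
def mob (z ζ : ℂ) : ℂ := z.re + z.im * I * ((1 + ζ) / (1 - ζ))

/-- Conformal map of the upper half-plane onto the disc sending `u` to `0`. -/
def cay (u w : ℂ) : ℂ := (w - u) / (w - (starRingEnd ℂ) u)

lemma isOpen_UHP : IsOpen UHP := isOpen_lt continuous_const continuous_im

lemma convex_UHP : Convex ℝ UHP := convex_halfSpace_im_gt 0

lemma one_sub_ne {ζ : ℂ} (hζ : ζ ∈ ball (0:ℂ) 1) : 1 - ζ ≠ 0 := by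
  intro h
  have : ζ = 1 := by linear_combination -h
  rw [this] at hζ; simp at hζ

lemma mob_zero (z : ℂ) : mob z 0 = z := by
  simp [mob, Complex.re_add_im]

lemma mob_hasDerivAt (z : ℂ) {ζ : ℂ} (hζ : ζ ∈ ball (0:ℂ) 1) :
    HasDerivAt (mob z) (z.im * I * (2 / (1 - ζ) ^ 2)) ζ := by
  have h1 := (((hasDerivAt_id ζ).const_add 1).div ((hasDerivAt_id ζ).const_sub 1)
    (one_sub_ne hζ)).const_mul (z.im * I : ℂ) |>.const_add (z.re : ℂ)
  refine HasDerivAt.congr_deriv h1 ?_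
  simp only [id_eq]
  ring

lemma mob_mem {z : ℂ} (hz : z ∈ UHP) {ζ : ℂ} (hζ : ζ ∈ ball (0:ℂ) 1) : mob z ζ ∈ UHP := by
  have hz' : 0 < z.im := hz
  have h1 : (mob z ζ).im = z.im * ((1 - normSq ζ) / normSq (1 - ζ)) := by
    have : (mob z ζ).im = z.im * ((1 + ζ) / (1 - ζ)).re := by
      simp [mob]
    rw [this, Complex.div_re]
    congr 1
    rw [← add_div]
    congr 1
    simp [normSq_apply]; ring
  show 0 < (mob z ζ).im
  rw [h1]
  have h2 : 0 < normSq (1 - ζ) := normSq_pos.2 (one_sub_ne hζ)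
  have h3 : normSq ζ < 1 := by
    rw [normSq_eq_norm_sq]
    have : ‖ζ‖ < 1 := by simpa using hζ
    nlinarith [norm_nonneg ζ]
  have : 0 < 1 - normSq ζ := by linarith
  positivity

lemma mob_injOn {z : ℂ} (hz : z ∈ UHP) : InjOn (mob z) (ball 0 1) := by
  intro a ha b hb h
  have hz' : (z.im : ℂ) ≠ 0 := by
    have : 0 < z.im := hz
    exact_mod_cast this.ne'
  have h1 : z.im * I * ((1 + a) / (1 - a)) = z.im * I * ((1 + b) / (1 - b)) := by
    simpa [mob] using h
  have h2 := mul_left_cancel₀ (mul_ne_zero hz' I_ne_zero) h1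
  rw [div_eq_div_iff (one_sub_ne ha) (one_sub_ne hb)] at h2
  linear_combination h2 / 2

lemma sub_conj_ne {u w : ℂ} (hu : u ∈ UHP) (hw : w ∈ UHP) : w - (starRingEnd ℂ) u ≠ 0 := by
  intro h
  have h1 := congrArg Complex.im h
  simp at h1
  have hu' : 0 < u.im := hu
  have hw' : 0 < w.im := hw
  linarith

lemma cay_mem {u w : ℂ} (hu : u ∈ UHP) (hw : w ∈ UHP) : cay u w ∈ ball (0:ℂ) 1 := by
  have hu' : 0 < u.im := hu
  have hw' : 0 < w.im := hw
  have h1 := norm_pos_iff.2 (sub_conj_ne hu hw)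
  rw [mem_ball_zero_iff, cay, norm_div, div_lt_one h1]
  apply lt_of_pow_lt_pow_left₀ 2 h1.le
  rw [← normSq_eq_norm_sq, ← normSq_eq_norm_sq, normSq_apply, normSq_apply]
  simp
  nlinarith [mul_pos hu' hw']

lemma cay_self (u : ℂ) : cay u u = 0 := by simp [cay]

lemma cay_hasDerivAt {u w : ℂ} (hu : u ∈ UHP) (hw : w ∈ UHP) :
    HasDerivAt (cay u) ((u - (starRingEnd ℂ) u) / (w - (starRingEnd ℂ) u) ^ 2) w := by
  have h1 := ((hasDerivAt_id w).sub_const u).div ((hasDerivAt_id w).sub_const ((starRingEnd ℂ) u))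
    (sub_conj_ne hu hw)
  refine HasDerivAt.congr_deriv h1 ?_
  simp only [id_eq]
  ring

lemma norm_cay_deriv {u : ℂ} (hu : u ∈ UHP) :
    ‖(u - (starRingEnd ℂ) u) / (u - (starRingEnd ℂ) u) ^ 2‖ = 1 / (2 * u.im) := by
  have hu' : 0 < u.im := hu
  have h1 : u - (starRingEnd ℂ) u = (2 * u.im : ℝ) * I := Complex.sub_conj u
  have h2 : ‖u - (starRingEnd ℂ) u‖ = 2 * u.im := by
    rw [h1]; simp [abs_of_pos hu']
  rw [norm_div, norm_pow, h2]
  field_simp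

lemma koebe_hp (F : ℂ → ℂ) (hF : DifferentiableOn ℂ F UHP) (hinj : InjOn F UHP)
    (hne : ∀ z ∈ UHP, F z ≠ 0) {z : ℂ} (hz : z ∈ UHP) : ‖deriv F z‖ * z.im ≤ 2 * ‖F z‖ := by
  have hz' : 0 < z.im := hz
  have h0m : (0:ℂ) ∈ ball (0:ℂ) 1 := mem_ball_self one_pos
  have h1 := koebe_disc (F ∘ mob z)
    (hF.comp (fun ζ hζ => (mob_hasDerivAt z hζ).differentiableAt.differentiableWithinAt)
      (fun ζ hζ => mob_mem hz hζ))
    (hinj.comp (mob_injOn hz) (fun ζ hζ => mob_mem hz hζ))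
    (fun ζ hζ => hne _ (mob_mem hz hζ))
  have hd : HasDerivAt F (deriv F (mob z 0)) (mob z 0) :=
    (hF.differentiableAt (isOpen_UHP.mem_nhds (mob_mem hz h0m))).hasDerivAt
  have h2 := hd.comp 0 (mob_hasDerivAt z h0m)
  rw [h2.deriv] at h1
  simp only [comp_apply, mob_zero] at h1
  rw [norm_mul] at h1
  have h3 : ‖(z.im * I * (2 / (1 - 0) ^ 2) : ℂ)‖ = 2 * z.im := by
    simp [abs_of_pos hz', mul_comm]
  rw [h3] at h1
  linarith

lemma schwarz_pick (h : ℂ → ℂ) (hh : DifferentiableOn ℂ h UHP) (hm : MapsTo h UHP UHP)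
    {z w : ℂ} (hz : z ∈ UHP) (hw : w ∈ UHP) : ‖cay (h z) (h w)‖ ≤ ‖cay z w‖ := by
  have hz' : 0 < z.im := hz
  have h0m : (0:ℂ) ∈ ball (0:ℂ) 1 := mem_ball_self one_pos
  have hinv : mob z (cay z w) = w := by
    have hne := sub_conj_ne hz hw
    have h2 : w - (starRingEnd ℂ) z ≠ 0 := hne
    have h1 := one_sub_ne (cay_mem hz hw)
    have h3 := sub_conj_ne hz hz
    have e1 : z.im * I = (z - (starRingEnd ℂ) z) / 2 := by
      rw [Complex.sub_conj]; push_cast; ring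
    have e2 : (z.re : ℂ) = (z + (starRingEnd ℂ) z) / 2 := by
      rw [Complex.add_conj]; push_cast; ring
    have e3 : 1 - cay z w = (z - (starRingEnd ℂ) z) / (w - (starRingEnd ℂ) z) := by
      rw [cay]; field_simp; ring
    rw [mob, e3, e1, e2, cay]
    field_simp
    ring
  have h1 := norm_le_norm_of_mapsTo_ball (f := fun ζ => cay (h z) (h (mob z ζ))) (R := 1)
    (z := cay z w) ?_ ?_ ?_ ?_
  · simpa [hinv] using h1
  · intro ζ hζ
    have hmm := mob_mem hz hζ
    apply DifferentiableAt.differentiableWithinAt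
    have d1 := (hh.differentiableAt (isOpen_UHP.mem_nhds hmm))
    have d2 := d1.comp ζ (mob_hasDerivAt z hζ).differentiableAt
    exact (cay_hasDerivAt (hm hz) (hm hmm)).differentiableAt.comp ζ d2
  · intro ζ hζ
    exact ball_subset_closedBall (cay_mem (hm hz) (hm (mob_mem hz hζ)))
  · simp [mob_zero, cay_self]
  · simpa using cay_mem hz hw

lemma schwarz_pick_ball (h : ℂ → ℂ) {c : ℂ} {R : ℝ} (hR : 0 < R)
    (hh : DifferentiableOn ℂ h (ball c R)) (hm : MapsTo h (ball c R) UHP) :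
    ‖deriv h c‖ ≤ 2 * (h c).im / R := by
  have hc : c ∈ ball c R := mem_ball_self hR
  have hu : 0 < (h c).im := hm hc
  have hd : ∀ z ∈ ball c R, HasDerivAt h (deriv h z) z := fun z hz =>
    (hh.differentiableAt (isOpen_ball.mem_nhds hz)).hasDerivAt
  have h1 := norm_deriv_le_div_of_mapsTo_ball (f := fun ζ => cay (h c) (h ζ)) (R₂ := 1) (c := c)
    (R₁ := R) ?_ ?_ hR
  · have h2 := (cay_hasDerivAt (hm hc) (hm hc)).comp c (hd c hc)
    have h3 : deriv (fun ζ => cay (h c) (h ζ)) c = _ := h2.deriv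
    rw [h3, norm_mul, norm_cay_deriv (hm hc)] at h1
    rw [one_div_mul_eq_div, div_le_div_iff₀ (by positivity) hR] at h1
    rw [le_div_iff₀ hR]; linarith
  · intro ζ hζ
    exact ((cay_hasDerivAt (hm hc) (hm hζ)).comp ζ (hd ζ hζ)).differentiableAt.differentiableWithinAt
  · intro ζ hζ
    simp only [cay_self]
    exact ball_subset_closedBall (cay_mem (hm hc) (hm hζ))

lemma schwarz_pick_deriv (h : ℂ → ℂ) (hh : DifferentiableOn ℂ h UHP) (hm : MapsTo h UHP UHP)
    {z : ℂ} (hz : z ∈ UHP) : ‖deriv h z‖ ≤ (h z).im / z.im := by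
  have hz' : 0 < z.im := hz
  have h0m : (0:ℂ) ∈ ball (0:ℂ) 1 := mem_ball_self one_pos
  have h1 := schwarz_pick_ball (h ∘ mob z) one_pos
    (hh.comp (fun ζ hζ => (mob_hasDerivAt z hζ).differentiableAt.differentiableWithinAt)
      (fun ζ hζ => mob_mem hz hζ)) (fun ζ hζ => hm (mob_mem hz hζ))
  have hd : HasDerivAt h (deriv h (mob z 0)) (mob z 0) :=
    (hh.differentiableAt (isOpen_UHP.mem_nhds (mob_mem hz h0m))).hasDerivAt
  have h2 := hd.comp 0 (mob_hasDerivAt z h0m)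
  rw [h2.deriv] at h1
  simp only [comp_apply, mob_zero] at h1
  rw [norm_mul] at h1
  have h3 : ‖(z.im * I * (2 / (1 - 0) ^ 2) : ℂ)‖ = 2 * z.im := by
    simp [abs_of_pos hz', mul_comm]
  rw [h3] at h1
  rw [le_div_iff₀ hz']
  linarith


lemma one_sub_cay {u w : ℂ} (hu : u ∈ UHP) (hw : w ∈ UHP) :
    1 - ‖cay u w‖ ^ 2 = 4 * u.im * w.im / ‖w - (starRingEnd ℂ) u‖ ^ 2 := by
  have h1 := norm_pos_iff.2 (sub_conj_ne hu hw)
  rw [cay, norm_div, div_pow, eq_div_iff (by positivity), sub_mul,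
    div_mul_cancel₀ _ (by positivity)]
  rw [← normSq_eq_norm_sq, ← normSq_eq_norm_sq, normSq_apply, normSq_apply]
  simp
  ring

lemma julia_limit {a : ℕ → ℂ} (c : ℂ)
    (ha : Tendsto (fun n : ℕ => a n - n * I) atTop (nhds 0)) :
    Tendsto (fun n : ℕ => (n : ℝ) * (a n).im / ‖a n - c‖ ^ 2) atTop (nhds 1) := by
  have hn : Tendsto (fun n : ℕ => ((n : ℂ))⁻¹) atTop (nhds 0) :=
    tendsto_inv_atTop_nhds_zero_nat
  have h1 : Tendsto (fun n : ℕ => I + (a n - n * I) * ((n:ℂ))⁻¹) atTop (nhds I) := by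
    simpa using (ha.mul hn).const_add I
  have h2 : Tendsto (fun n : ℕ => I + (a n - n * I) * ((n:ℂ))⁻¹ - c * ((n:ℂ))⁻¹) atTop (nhds I) := by
    simpa using h1.sub (hn.const_mul c)
  have h3 := (Complex.continuous_im.tendsto _).comp h1
  have h4 := (h2.norm).pow 2
  have h5 := h3.div h4 (by simp)
  simp only [I_im, norm_I, one_pow, div_one] at h5
  refine h5.congr' ?_
  filter_upwards [eventually_gt_atTop 0] with n hn0
  have hnz : (n : ℂ) ≠ 0 := by exact_mod_cast hn0.ne'
  have hnr : (n : ℝ) ≠ 0 := by exact_mod_cast hn0.ne'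
  have e1 : I + (a n - n * I) * ((n:ℂ))⁻¹ = a n / n := by field_simp; ring
  have e2 : a n / n - c * ((n:ℂ))⁻¹ = (a n - c) / n := by field_simp
  simp only [comp_apply, Pi.div_apply, e1, e2]
  rw [norm_div, Complex.norm_natCast]
  have e3 : (a n / n).im = (a n).im / n := by
    rw [← Complex.ofReal_natCast, Complex.div_ofReal_im]
  rw [e3]
  by_cases hz : ‖a n - c‖ = 0
  · simp [hz]
  · field_simp

lemma julia (ψ : ℂ → ℂ) (hψ : DifferentiableOn ℂ ψ UHP) (hm : MapsTo ψ UHP UHP) (a b : ℕ → ℂ)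
    (haU : ∀ᶠ n in atTop, a n ∈ UHP ∧ ψ (a n) = b n)
    (ha : Tendsto (fun n : ℕ => a n - n * I) atTop (nhds 0))
    (hb : Tendsto (fun n : ℕ => b n - n * I) atTop (nhds 0)) {z : ℂ} (hz : z ∈ UHP) :
    z.im ≤ (ψ z).im := by
  have l1 := (julia_limit ((starRingEnd ℂ) z) ha).const_mul z.im
  have l2 := (julia_limit ((starRingEnd ℂ) (ψ z)) hb).const_mul (ψ z).im
  rw [mul_one] at l1 l2
  refine le_of_tendsto_of_tendsto l1 l2 ?_
  filter_upwards [haU] with n hn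
  obtain ⟨hn1, hn2⟩ := hn
  have h1 := schwarz_pick ψ hψ hm hz hn1
  have h2 := one_sub_cay hz hn1
  have h3 := one_sub_cay (hm hz) (hm hn1)
  have h4 : ‖cay (ψ z) (ψ (a n))‖ ^ 2 ≤ ‖cay z (a n)‖ ^ 2 := by gcongr
  rw [hn2] at h3 h4
  have h5 : 4 * z.im * (a n).im / ‖a n - (starRingEnd ℂ) z‖ ^ 2 ≤
    4 * (ψ z).im * (b n).im / ‖b n - (starRingEnd ℂ) (ψ z)‖ ^ 2 := by linarith
  have h6 := mul_le_mul_of_nonneg_left h5 (show (0:ℝ) ≤ n / 4 by positivity)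
  calc _ = (n / 4 : ℝ) * (4 * z.im * (a n).im / ‖a n - (starRingEnd ℂ) z‖ ^ 2) := by ring
    _ ≤ _ := h6
    _ = _ := by ring

lemma nhds_le_map_of_injOn {U : Set ℂ} (hU : IsOpen U) {f : ℂ → ℂ} (hf : DifferentiableOn ℂ f U)
    (hinj : InjOn f U) {z : ℂ} (hz : z ∈ U) : nhds (f z) ≤ map f (nhds z) := by
  have han : AnalyticAt ℂ f z := hf.analyticAt (hU.mem_nhds hz)
  rcases han.eventually_constant_or_nhds_le_map_nhds with h | h
  · exfalso
    have h1 : ∀ᶠ w in nhds z, w = z := by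
      filter_upwards [h, hU.mem_nhds hz] with w hw hwU using hinj hwU hz hw
    have h2 : ∀ᶠ w in nhdsWithin z {z}ᶜ, False := by
      filter_upwards [h1.filter_mono nhdsWithin_le_nhds, self_mem_nhdsWithin] with w hw hw2
      exact hw2 hw
    simp at h2
    exact (NeBot.ne inferInstance h2)
  · exact h

lemma inv_continuousAt {U : Set ℂ} (hU : IsOpen U) {f g : ℂ → ℂ} (hf : DifferentiableOn ℂ f U)
    (hinj : InjOn f U) (hg : LeftInvOn g f U) {z : ℂ} (hz : z ∈ U) : ContinuousAt g (f z) := by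
  rw [ContinuousAt, hg hz]
  intro V hV
  have h1 := nhds_le_map_of_injOn hU hf hinj hz (image_mem_map (inter_mem hV (hU.mem_nhds hz)))
  show g ⁻¹' V ∈ nhds (f z)
  refine mem_of_superset h1 ?_
  rintro _ ⟨w, ⟨hw1, hw2⟩, rfl⟩
  show g (f w) ∈ V
  rwa [hg hw2]

lemma inv_hasDerivAt_aux {U : Set ℂ} (hU : IsOpen U) {f g : ℂ → ℂ} (hf : DifferentiableOn ℂ f U)
    (hinj : InjOn f U) (hg : LeftInvOn g f U) {z : ℂ} (hz : z ∈ U) (hd : deriv f z ≠ 0) :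
    HasDerivAt g (deriv f z)⁻¹ (f z) := by
  have hfz := (hf.differentiableAt (hU.mem_nhds hz)).hasDerivAt
  refine HasDerivAt.of_local_left_inverse (f := f) (inv_continuousAt hU hf hinj hg hz) ?_ hd ?_
  · rwa [hg hz]
  · have h1 := nhds_le_map_of_injOn hU hf hinj hz (image_mem_map (hU.mem_nhds hz))
    filter_upwards [h1]
    rintro _ ⟨w, hw, rfl⟩
    rw [hg hw]

lemma deriv_ne_zero_of_injOn' {U : Set ℂ} (hU : IsOpen U) {f g : ℂ → ℂ}
    (hf : DifferentiableOn ℂ f U)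
    (hinj : InjOn f U) (hg : LeftInvOn g f U) {z : ℂ} (hz : z ∈ U) : deriv f z ≠ 0 := by
  intro hd
  have hfz := (hf.differentiableAt (hU.mem_nhds hz)).hasDerivAt
  have han : AnalyticAt ℂ (deriv f) z := (hf.deriv hU).analyticAt (hU.mem_nhds hz)
  rcases han.eventually_eq_zero_or_eventually_ne_zero with h | h
  · -- locally constant
    obtain ⟨r, hr, hrs⟩ := Metric.eventually_nhds_iff_ball.1 (h.and (hU.mem_nhds hz))
    have hzr := mem_ball_self (x := z) hr
    have hw : z + (r / 2 : ℝ) ∈ ball z r := by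
      simp [abs_of_pos hr]; linarith
    have := isOpen_ball.is_const_of_deriv_eq_zero (convex_ball z r).isPreconnected
      (hf.mono fun w hw => (hrs w hw).2) (fun w hw => (hrs w hw).1) hw hzr
    have h2 := hinj (hrs _ hw).2 hz this
    have h3 : ((r / 2 : ℝ) : ℂ) = 0 := by linear_combination h2
    have h4 : r / 2 = 0 := by exact_mod_cast h3
    linarith
  · rw [eventually_nhdsWithin_iff] at h
    have h1 := nhds_le_map_of_injOn hU hf hinj hz (image_mem_map (inter_mem h (hU.mem_nhds hz)))
    have hga : AnalyticAt ℂ g (f z) := by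
      apply analyticAt_of_differentiable_on_punctured_nhds_of_continuousAt
      · rw [eventually_nhdsWithin_iff]
        filter_upwards [h1]
        rintro _ ⟨w, ⟨hw1, hw2⟩, rfl⟩ hne
        refine (inv_hasDerivAt_aux hU hf hinj hg hw2 (hw1 ?_)).differentiableAt
        intro hh
        apply hne
        rw [mem_singleton_iff] at *
        rw [hh]
      · exact inv_continuousAt hU hf hinj hg hz
    have h2 := hga.differentiableAt.hasDerivAt.comp z hfz
    rw [hd, mul_zero] at h2
    have h3 : HasDerivAt (g ∘ f) 1 z := by
      refine (hasDerivAt_id z).congr_of_eventuallyEq ?_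
      filter_upwards [hU.mem_nhds hz] with w hw
      simp [hg hw]
    exact one_ne_zero (h3.unique h2)

lemma inv_hasDerivAt {U : Set ℂ} (hU : IsOpen U) {f g : ℂ → ℂ} (hf : DifferentiableOn ℂ f U)
    (hinj : InjOn f U) (hg : LeftInvOn g f U) {z : ℂ} (hz : z ∈ U) :
    HasDerivAt g (deriv f z)⁻¹ (f z) :=
  inv_hasDerivAt_aux hU hf hinj hg hz (deriv_ne_zero_of_injOn' hU hf hinj hg hz)

lemma hull_height {K : Set ℂ} (hK : IsHull K) {w₀ : ℂ} (hw : w₀ ∈ K) : w₀.im ≤ Metric.diam K := by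
  obtain ⟨hb, hsub, hopen, -, hsc⟩ := hK
  by_contra hcon
  push Not at hcon
  obtain ⟨r, hr1, hr2⟩ := exists_between hcon
  have hr0 : 0 < r := Metric.diam_nonneg.trans_lt hr1
  have hsc' : IsSimplyConnected (UHP \ K) := by
    exact hsc
  obtain ⟨L, hLc, hL⟩ := Complex.exists_continuousOn_eqOn_exp_comp hsc' hopen
    (g := fun w => w - w₀) (by fun_prop) (by
      rintro ⟨w, hw1, hw2⟩
      have : w = w₀ := by linear_combination hw2
      exact hw1.2 (this ▸ hw))
  have hmem : ∀ w ∈ sphere w₀ r, w ∈ UHP \ K := by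
    intro w hws
    have hd : dist w w₀ = r := hws
    constructor
    · show 0 < w.im
      have h1 : |(w - w₀).im| ≤ ‖w - w₀‖ := Complex.abs_im_le_norm _
      rw [← dist_eq_norm, hd, Complex.sub_im] at h1
      have := (abs_le.1 h1).1
      linarith
    · intro hwK
      have := Metric.dist_le_diam_of_mem hb hwK hw
      linarith
  have hder : ∀ w ∈ UHP \ K, HasDerivAt L ((w - w₀)⁻¹) w := by
    intro w hw1
    have hnh := hopen.mem_nhds hw1
    have hLw : exp (L w) = w - w₀ := hL hw1
    have h1 : HasDerivAt (fun y => exp y + w₀) (exp (L w)) (L w) :=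
      (Complex.hasDerivAt_exp _).add_const _
    rw [← hLw]
    refine HasDerivAt.of_local_left_inverse (f := fun y => exp y + w₀)
      (hLc.continuousAt hnh) h1 (exp_ne_zero _) ?_
    filter_upwards [hnh] with y hy
    have : exp (L y) = y - w₀ := hL hy
    rw [this]; ring
  have h1 := circleIntegral.integral_eq_zero_of_hasDerivWithinAt (f := L)
    (f' := fun w => (w - w₀)⁻¹) (c := w₀) hr0.le
    (fun w hw => (hder w (hmem w hw)).hasDerivWithinAt)
  have h2 := circleIntegral.integral_sub_center_inv w₀ hr0.ne'
  rw [h1] at h2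
  exact two_pi_I_ne_zero h2.symm


lemma tendsto_nI : Tendsto (fun n : ℕ => (n : ℂ) * I) atTop (cobounded ℂ ⊓ 𝓟 UHP) := by
  rw [tendsto_inf]
  constructor
  · rw [← tendsto_norm_atTop_iff_cobounded]
    simpa using tendsto_natCast_atTop_atTop (R := ℝ)
  · rw [tendsto_principal]
    filter_upwards [eventually_gt_atTop 0] with n hn
    show 0 < ((n : ℂ) * I).im
    simpa using hn

lemma nI_mem : ∀ᶠ n : ℕ in atTop, (n : ℂ) * I ∈ UHP := by
  filter_upwards [eventually_gt_atTop 0] with n hn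
  show 0 < ((n : ℂ) * I).im
  simpa using hn

lemma hydro_mapsTo {K : Set ℂ} {f : ℂ → ℂ} (hf : IsHydroMap K f) : MapsTo f UHP (UHP \ K) := by
  intro z hz
  rw [← hf.2.2.1]
  exact mem_image_of_mem f hz

lemma hydro_im {K : Set ℂ} {f : ℂ → ℂ} (hf : IsHydroMap K f) {z : ℂ} (hz : z ∈ UHP) :
    z.im ≤ (f z).im := by
  refine julia f hf.1 (fun w hw => (hydro_mapsTo hf hw).1) (fun n => (n : ℂ) * I)
    (fun n => f ((n : ℂ) * I)) ?_ ?_ ?_ hz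
  · filter_upwards [nI_mem] with n hn
    exact ⟨hn, rfl⟩
  · simp
  · exact hf.2.2.2.comp tendsto_nI

lemma cobounded_of_sub {α : Type*} {l : Filter α} {a b : α → ℂ} (ha : Tendsto a l (cobounded ℂ))
    (h : Tendsto (fun x => b x - a x) l (nhds 0)) : Tendsto b l (cobounded ℂ) := by
  rw [← tendsto_norm_atTop_iff_cobounded] at *
  have h1 : ∀ᶠ x in l, ‖b x - a x‖ < 1 := by
    have := h.norm
    rw [norm_zero] at this
    exact this.eventually_lt_const one_pos
  refine tendsto_atTop_mono' l ?_ (tendsto_atTop_add_const_right l (-1) ha)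
  filter_upwards [h1] with x hx
  have := norm_sub_norm_le (a x) (b x)
  rw [norm_sub_rev] at this
  linarith

lemma hydro_comp {K K' : Set ℂ} {f' g' fh : ℂ → ℂ} (hsub : K' ⊆ K) (hK : K ⊆ UHP)
    (hf' : IsHydroPair K' f' g') (hfh : IsHydroMap (g' '' (K \ K')) fh) :
    IsHydroMap K (f' ∘ fh) := by
  have hm : MapsTo fh UHP UHP := fun w hw => (hydro_mapsTo hfh hw).1
  refine ⟨hf'.1.1.comp hfh.1 hm, hf'.1.2.1.comp hfh.2.1 hm, ?_, ?_⟩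
  · rw [image_comp, hfh.2.2.1]
    ext w
    constructor
    · rintro ⟨u, ⟨hu1, hu2⟩, rfl⟩
      have h1 := hydro_mapsTo hf'.1 hu1
      refine ⟨h1.1, fun hk => hu2 ⟨f' u, ⟨hk, h1.2⟩, hf'.2.1 hu1⟩⟩
    · rintro ⟨hw1, hw2⟩
      have hw3 : w ∈ UHP \ K' := ⟨hw1, fun h => hw2 (hsub h)⟩
      have hw4 := hw3
      rw [← hf'.1.2.2.1] at hw4
      obtain ⟨u, hu, rfl⟩ := hw4
      refine ⟨u, ⟨hu, ?_⟩, rfl⟩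
      rintro ⟨v, ⟨hv1, hv2⟩, hv⟩
      apply hw2
      rw [← hv, hf'.2.2 ⟨hK hv1, hv2⟩]
      exact hv1
  · have h1 : Tendsto fh (cobounded ℂ ⊓ 𝓟 UHP) (cobounded ℂ ⊓ 𝓟 UHP) := by
      rw [tendsto_inf]
      refine ⟨cobounded_of_sub (tendsto_id'.2 inf_le_left) hfh.2.2.2, ?_⟩
      rw [tendsto_principal]
      exact eventually_inf_principal.2 (Eventually.of_forall hm)
    have h2 := (hf'.1.2.2.2.comp h1).add hfh.2.2.2
    rw [add_zero] at h2
    refine h2.congr fun z => ?_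
    simp

lemma holder_cobounded {f : ℂ → ℂ} {β C₀ : ℝ} (hβ : 0 < β) (hC : 0 < C₀) (hf : IsHolder f β C₀)
    {a : ℕ → ℂ} (ha : ∀ᶠ n in atTop, a n ∈ UHP)
    (h : Tendsto (fun n => f (a n)) atTop (cobounded ℂ)) : Tendsto a atTop (cobounded ℂ) := by
  rw [← tendsto_norm_atTop_iff_cobounded] at *
  rw [Filter.tendsto_atTop] at h ⊢
  intro R
  have hI : I ∈ UHP := by show 0 < I.im; simp
  filter_upwards [ha, h (‖f I‖ + C₀ * max ((|R| + 1) ^ β) (|R| + 1) + 1)] with n h1 h2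
  by_contra hc
  push Not at hc
  have hd : dist (a n) I ≤ |R| + 1 := by
    rw [dist_eq_norm]
    refine (norm_sub_le _ _).trans ?_
    rw [norm_I]
    linarith [le_abs_self R]
  have h3 := hf _ h1 _ hI
  have h4 : C₀ * max (dist (a n) I ^ β) (dist (a n) I) ≤
      C₀ * max ((|R| + 1) ^ β) (|R| + 1) := by
    gcongr
  have h5 : ‖f (a n)‖ ≤ ‖f I‖ + dist (f (a n)) (f I) := by
    rw [dist_eq_norm]; exact norm_le_norm_add_norm_sub' _ _
  linarith

lemma hydro_unique {K : Set ℂ} {f g p : ℂ → ℂ} {β C₀ : ℝ} (hβ : 0 < β) (hC : 0 < C₀)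
    (hol : IsHolder f β C₀) (hf : IsHydroPair K f g) (hp : IsHydroMap K p) : EqOn f p UHP := by
  obtain ⟨q, hq⟩ : ∃ q : ℂ → ℂ, InvOn q p UHP (UHP \ K) := by
    have hb : BijOn p UHP (UHP \ K) := ⟨hydro_mapsTo hp, hp.2.1, by rw [SurjOn, hp.2.2.1]⟩
    exact ⟨_, hb.invOn_invFunOn⟩
  have hgm : MapsTo g (UHP \ K) UHP := by
    intro w hw
    rw [← hf.1.2.2.1] at hw
    obtain ⟨u, hu, rfl⟩ := hw
    rwa [hf.2.1 hu]
  have hqm : MapsTo q (UHP \ K) UHP := by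
    intro w hw
    rw [← hp.2.2.1] at hw
    obtain ⟨u, hu, rfl⟩ := hw
    rwa [hq.1 hu]
  have hgd : DifferentiableOn ℂ g (UHP \ K) := by
    intro w hw
    rw [← hf.1.2.2.1] at hw
    obtain ⟨u, hu, rfl⟩ := hw
    exact (inv_hasDerivAt isOpen_UHP hf.1.1 hf.1.2.1 hf.2.1 hu).differentiableAt.differentiableWithinAt
  have hqd : DifferentiableOn ℂ q (UHP \ K) := by
    intro w hw
    rw [← hp.2.2.1] at hw
    obtain ⟨u, hu, rfl⟩ := hw
    exact (inv_hasDerivAt isOpen_UHP hp.1 hp.2.1 hq.1 hu).differentiableAt.differentiableWithinAt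
  have hψd : DifferentiableOn ℂ (g ∘ p) UHP := hgd.comp hp.1 (hydro_mapsTo hp)
  have hθd : DifferentiableOn ℂ (q ∘ f) UHP := hqd.comp hf.1.1 (hydro_mapsTo hf.1)
  have hψm : MapsTo (g ∘ p) UHP UHP := hgm.comp (hydro_mapsTo hp)
  have hθm : MapsTo (q ∘ f) UHP UHP := hqm.comp (hydro_mapsTo hf.1)
  have hfa : ∀ z ∈ UHP, f (g (p z)) = p z := fun z hz => hf.2.2 (hydro_mapsTo hp hz)
  let a : ℕ → ℂ := fun n => g (p ((n : ℂ) * I))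
  have haU : ∀ᶠ n in atTop, a n ∈ UHP := by
    filter_upwards [nI_mem] with n hn using hψm hn
  have hpn : Tendsto (fun n : ℕ => p ((n : ℂ) * I) - (n : ℂ) * I) atTop (nhds 0) :=
    hp.2.2.2.comp tendsto_nI
  have hpc : Tendsto (fun n : ℕ => p ((n : ℂ) * I)) atTop (cobounded ℂ) :=
    cobounded_of_sub (tendsto_inf.1 tendsto_nI).1 hpn
  have hfac : Tendsto (fun n => f (a n)) atTop (cobounded ℂ) := by
    refine hpc.congr' ?_
    filter_upwards [nI_mem] with n hn using (hfa _ hn).symm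
  have hac : Tendsto a atTop (cobounded ℂ ⊓ 𝓟 UHP) :=
    tendsto_inf.2 ⟨holder_cobounded hβ hC hol haU hfac, tendsto_principal.2 haU⟩
  have han : Tendsto (fun n : ℕ => a n - n * I) atTop (nhds 0) := by
    have h1 := hpn.sub (hf.1.2.2.2.comp hac)
    rw [sub_zero] at h1
    refine h1.congr' ?_
    filter_upwards [nI_mem] with n hn
    simp only [Function.comp]
    show _ - (f (g (p (n * I))) - a n) = _
    rw [hfa _ hn]; ring
  have hnn : Tendsto (fun n : ℕ => (n : ℂ) * I - n * I) atTop (nhds 0) := by simp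
  have h1 : ∀ z ∈ UHP, z.im ≤ ((g ∘ p) z).im := fun z hz =>
    julia _ hψd hψm (fun n => (n : ℂ) * I) a (by
      filter_upwards [nI_mem] with n hn using ⟨hn, rfl⟩) hnn han hz
  have h2 : ∀ z ∈ UHP, z.im ≤ ((q ∘ f) z).im := fun z hz =>
    julia _ hθd hθm a (fun n => (n : ℂ) * I) (by
      filter_upwards [nI_mem] with n hn
      refine ⟨hψm hn, ?_⟩
      show q (f (g (p (n * I)))) = _
      rw [hfa _ hn, hq.1 hn]) han hnn hz
  have h3 : ∀ z ∈ UHP, ((g ∘ p) z - z).im = 0 := by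
    intro z hz
    have e1 := h1 z hz
    have e2 := h2 _ (hψm hz)
    have e3 : (q ∘ f) ((g ∘ p) z) = z := by
      show q (f (g (p z))) = z
      rw [hfa z hz, hq.1 hz]
    rw [e3] at e2
    rw [sub_im]; linarith
  have hand : AnalyticOnNhd ℂ (fun z => (g ∘ p) z - z) UHP :=
    (hψd.sub differentiableOn_id).analyticOnNhd isOpen_UHP
  have hpc' : IsPreconnected UHP := convex_UHP.isPreconnected
  obtain ⟨c, hc⟩ := hand.eq_const_of_im_eq_const (c₀ := 0) h3 isOpen_UHP ⟨⟨I, by show 0 < I.im; simp⟩, hpc'⟩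
  have hc0 : c = 0 := by
    refine tendsto_nhds_unique (f := fun n : ℕ => a n - n * I) ?_ han
    refine tendsto_const_nhds.congr' ?_
    filter_upwards [nI_mem] with n hn
    exact (hc _ hn).symm
  intro z hz
  have h5 := hc z hz
  rw [hc0, sub_eq_zero] at h5
  have h6 := hfa z hz
  have h7 : g (p z) = z := h5
  rwa [h7] at h6


lemma vline_mem (x : ℝ) {t : ℝ} (ht : 0 < t) : (x : ℂ) + t * I ∈ UHP := by
  show 0 < ((x : ℂ) + t * I).im
  simpa using ht

lemma vline_deriv {F : ℂ → ℂ} (hF : DifferentiableOn ℂ F UHP) (x : ℝ) {t : ℝ} (ht : 0 < t) :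
    HasDerivAt (fun s : ℝ => F ((x : ℂ) + s * I)) (deriv F ((x : ℂ) + t * I) * I) t := by
  have h1 := (hF.differentiableAt (isOpen_UHP.mem_nhds (vline_mem x ht))).hasDerivAt
  have h2 : HasDerivAt (fun s : ℝ => (x : ℂ) + s * I) (1 * I) t :=
    ((HasDerivAt.ofReal_comp (hasDerivAt_id t)).mul_const I).const_add _
  rw [one_mul] at h2
  exact h1.comp t h2

lemma koebe_growth {F : ℂ → ℂ} (hF : DifferentiableOn ℂ F UHP) (hinj : InjOn F UHP)
    (hne : ∀ z ∈ UHP, F z ≠ 0) (x : ℝ) {s R : ℝ} (hs : 0 < s) (hsR : s ≤ R) :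
    ‖F ((x : ℂ) + R * I)‖ * s ^ 2 ≤ ‖F ((x : ℂ) + s * I)‖ * R ^ 2 := by
  have hR : 0 < R := hs.trans_le hsR
  have hder : ∀ t ∈ Ioi (0 : ℝ), HasDerivAt (fun t : ℝ => ‖F ((x : ℂ) + t * I)‖ ^ 2 / t ^ 4)
      ((2 * inner ℝ (F ((x : ℂ) + t * I)) (deriv F ((x : ℂ) + t * I) * I) * t ^ 4 -
        ‖F ((x : ℂ) + t * I)‖ ^ 2 * (4 * t ^ 3)) / (t ^ 4) ^ 2) t := by
    intro t ht
    have ht' : (0 : ℝ) < t := ht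
    have h1 := (vline_deriv hF x ht').norm_sq
    have h2 : HasDerivAt (fun t : ℝ => t ^ 4) (4 * t ^ 3) t := by
      simpa using hasDerivAt_pow 4 t
    exact h1.div h2 (by positivity)
  have hanti : AntitoneOn (fun t : ℝ => ‖F ((x : ℂ) + t * I)‖ ^ 2 / t ^ 4) (Ioi 0) := by
    refine antitoneOn_of_deriv_nonpos (convex_Ioi 0)
      (fun t ht => (hder t ht).continuousAt.continuousWithinAt)
      (fun t ht => (hder t (interior_subset ht)).differentiableAt.differentiableWithinAt) ?_
    intro t ht
    have ht := interior_subset ht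
    have ht' : (0 : ℝ) < t := ht
    rw [(hder t ht).deriv]
    refine div_nonpos_of_nonpos_of_nonneg ?_ (by positivity)
    have hk := koebe_hp F hF hinj hne (vline_mem x ht')
    have him : ((x : ℂ) + t * I).im = t := by simp
    rw [him] at hk
    have hi := real_inner_le_norm (F ((x : ℂ) + t * I)) (deriv F ((x : ℂ) + t * I) * I)
    rw [norm_mul, norm_I, mul_one] at hi
    set A := ‖F ((x : ℂ) + t * I)‖
    set B := ‖deriv F ((x : ℂ) + t * I)‖
    have hA : 0 ≤ A := norm_nonneg _
    have h3 : 0 < t ^ 3 := by positivity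
    have h5 : 2 * inner ℝ (F ((x : ℂ) + t * I)) (deriv F ((x : ℂ) + t * I) * I) * t ^ 4 ≤
        2 * (A * B) * t ^ 4 := by gcongr
    have h6 : 2 * (A * B) * t ^ 4 = 2 * A * t ^ 3 * (B * t) := by ring
    have h7 : 2 * A * t ^ 3 * (B * t) ≤ 2 * A * t ^ 3 * (2 * A) := by gcongr
    nlinarith
  have h := hanti (show s ∈ Ioi 0 from hs) (show R ∈ Ioi 0 from hR) hsR
  simp only at h
  rw [div_le_div_iff₀ (by positivity) (by positivity)] at h
  refine (pow_le_pow_iff_left₀ (by positivity) (by positivity) two_ne_zero).1 ?_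
  nlinarith

lemma dist_lower {K' : Set ℂ} {d : ℝ} (hd : 0 < d) (hK' : ∀ w ∈ K', w.im ≤ d) {f' : ℂ → ℂ}
    (hf' : IsHydroMap K' f') {u w₀ : ℂ} (hu : u ∈ UHP) (hw : w₀ ∉ UHP \ K') :
    min (u.im ^ 2 / (4 * d)) (u.im / 2) ≤ ‖f' u - w₀‖ := by
  have hu0 : 0 < u.im := hu
  have hw0 : w₀.im ≤ d := by
    by_cases h : w₀ ∈ UHP
    · by_contra hc
      exact hw ⟨h, fun hk => hc (hK' _ hk)⟩
    · have : ¬ (0 < w₀.im) := h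
      linarith
  have hlow : ∀ v ∈ UHP, v.im - d ≤ ‖f' v - w₀‖ := by
    intro v hv
    have h1 := hydro_im hf' hv
    have h2 := Complex.abs_im_le_norm (f' v - w₀)
    have h3 := le_abs_self (f' v - w₀).im
    rw [sub_im] at h2 h3
    linarith
  rcases le_total u.im (2 * d) with h | h
  · refine (min_le_left _ _).trans ?_
    have hk := koebe_growth (F := fun z => f' z - w₀) (hf'.1.sub_const _)
      (fun a ha b hb hab => hf'.2.1 ha hb (by linear_combination hab))
      (fun z hz h0 => hw (by
        have : f' z = w₀ := by linear_combination h0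
        rw [← this]; exact hydro_mapsTo hf' hz)) u.re hu0 h
    have e : (u.re : ℂ) + u.im * I = u := re_add_im u
    rw [e] at hk
    have h2 := hlow _ (vline_mem u.re (t := 2 * d) (by linarith))
    have e2 : ((u.re : ℂ) + (2 * d : ℝ) * I).im = 2 * d := by simp
    rw [e2] at h2
    rw [div_le_iff₀ (by positivity)]
    have h3 : d * u.im ^ 2 ≤ ‖f' ((u.re : ℂ) + (2 * d : ℝ) * I) - w₀‖ * u.im ^ 2 := by
      gcongr; linarith
    have h4 : d * u.im ^ 2 ≤ d * (‖f' u - w₀‖ * (4 * d)) := by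
      nlinarith
    exact le_of_mul_le_mul_left h4 hd
  · refine (min_le_right _ _).trans ?_
    have := hlow u hu
    linarith

lemma deriv_lower {K' : Set ℂ} {d : ℝ} (hd : 0 < d) (hK' : ∀ w ∈ K', w.im ≤ d) {f' g' : ℂ → ℂ}
    (hf' : IsHydroPair K' f' g') {u : ℂ} (hu : u ∈ UHP) :
    1 ≤ max (8 * d / u.im) 4 * ‖deriv f' u‖ := by
  have hu0 : 0 < u.im := hu
  set D := min (u.im ^ 2 / (4 * d)) (u.im / 2) with hD
  have hD0 : 0 < D := by rw [hD]; positivity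
  have hball : ball (f' u) D ⊆ UHP \ K' := by
    intro w hw
    by_contra hc
    have h1 := dist_lower hd hK' hf'.1 hu hc
    rw [mem_ball, dist_comm, dist_eq_norm] at hw
    linarith
  have hgm : MapsTo g' (UHP \ K') UHP := by
    intro w hw
    rw [← hf'.1.2.2.1] at hw
    obtain ⟨u, hu, rfl⟩ := hw
    rwa [hf'.2.1 hu]
  have hgd : DifferentiableOn ℂ g' (UHP \ K') := by
    intro w hw
    rw [← hf'.1.2.2.1] at hw
    obtain ⟨u, hu, rfl⟩ := hw
    exact (inv_hasDerivAt isOpen_UHP hf'.1.1 hf'.1.2.1 hf'.2.1 hu).differentiableAt.differentiableWithinAt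
  have h1 := schwarz_pick_ball g' hD0 (hgd.mono hball) (hgm.mono_left hball)
  rw [(inv_hasDerivAt isOpen_UHP hf'.1.1 hf'.1.2.1 hf'.2.1 hu).deriv, hf'.2.1 hu, norm_inv] at h1
  have hne := deriv_ne_zero_of_injOn' isOpen_UHP hf'.1.1 hf'.1.2.1 hf'.2.1 hu
  have hpos : 0 < ‖deriv f' u‖ := norm_pos_iff.2 hne
  have h2 : 2 * u.im / D ≤ max (8 * d / u.im) 4 := by
    rw [hD]
    rcases min_choice (u.im ^ 2 / (4 * d)) (u.im / 2) with h | h <;> rw [h]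
    · refine le_trans (le_of_eq ?_) (le_max_left _ _)
      field_simp; norm_num
    · refine le_trans (le_of_eq ?_) (le_max_right _ _)
      field_simp; norm_num
  rw [← div_le_iff₀ hpos, one_div]
  exact h1.trans h2

lemma holder_deriv {f : ℂ → ℂ} {β C₀ : ℝ} (hβ : 0 < β) (hβ1 : β ≤ 1) (hC : 0 < C₀)
    (hol : IsHolder f β C₀)
    (hf : DifferentiableOn ℂ f UHP) {z : ℂ} (hz : z ∈ UHP) :
    ‖deriv f z‖ ≤ 2 * C₀ * max (z.im ^ (β - 1)) 1 := by
  have hy : 0 < z.im := hz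
  set y := z.im with hyd
  have hsub : ball z (y / 2) ⊆ UHP := by
    intro w hw
    rw [mem_ball, dist_eq_norm] at hw
    have h1 := (abs_le.1 (Complex.abs_im_le_norm (w - z))).1
    rw [sub_im] at h1
    show 0 < w.im
    linarith
  have hmt : MapsTo f (ball z (y / 2)) (closedBall (f z) (C₀ * max (y ^ β) y)) := by
    intro w hw
    rw [mem_closedBall]
    refine (hol w (hsub hw) z hz).trans ?_
    rw [mem_ball] at hw
    have : dist w z ≤ y := by linarith
    gcongr
  have h := Complex.norm_deriv_le_div_of_mapsTo_ball (hf.mono hsub) hmt (by positivity)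
  refine h.trans (le_of_eq ?_)
  rw [Real.rpow_sub_one hy.ne']
  have h2 : max (y ^ β) y = y * max (y ^ β / y) 1 := by
    rw [mul_max_of_nonneg _ _ hy.le]
    congr 1 <;> field_simp
  rw [h2]
  field_simp

/-- The main derivative estimate. -/
lemma main_deriv {K' : Set ℂ} {d : ℝ} (hd : 0 < d) (hK' : ∀ w ∈ K', w.im ≤ d) {f f' g' h : ℂ → ℂ}
    {β C₀ : ℝ} (hβ : 0 < β) (hβ1 : β ≤ 1) (hC : 0 < C₀)
    (hf' : IsHydroPair K' f' g') (hol : IsHolder f β C₀) (hf : DifferentiableOn ℂ f UHP)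
    (hh : DifferentiableOn ℂ h UHP) (hm : MapsTo h UHP UHP) (heq : EqOn f (f' ∘ h) UHP)
    {z : ℂ} (hz : z ∈ UHP) :
    ‖deriv h z‖ ≤ (4 * √(d * C₀) + 8 * C₀ + 16 * d) * (z.im ^ (β / 2 - 1) + 1) := by
  have hy : 0 < z.im := hz
  have hu := hm hz
  have hY : 0 < (h z).im := hu
  have e : deriv f z = deriv f' (h z) * deriv h z := by
    have h1 := ((hf'.1.1.differentiableAt (isOpen_UHP.mem_nhds hu)).hasDerivAt).comp z
      ((hh.differentiableAt (isOpen_UHP.mem_nhds hz)).hasDerivAt)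
    refine (h1.congr_of_eventuallyEq ?_).deriv
    filter_upwards [isOpen_UHP.mem_nhds hz] with w hw using heq hw
  have h1 := deriv_lower hd hK' hf' hu
  have h2 := holder_deriv hβ hβ1 hC hol hf hz
  have h3 := schwarz_pick_deriv h hh hm hz
  rw [e, norm_mul] at h2
  set y := z.im
  set Y := (h z).im
  set H := ‖deriv h z‖
  set P := ‖deriv f' (h z)‖
  have hH : 0 ≤ H := norm_nonneg _
  have hP : 0 ≤ P := norm_nonneg _
  have hmx : 0 < max (y ^ (β - 1)) 1 := lt_max_of_lt_right one_pos
  -- H ≤ max * (P H)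
  have h4 : H ≤ max (8 * d / Y) 4 * (2 * C₀ * max (y ^ (β - 1)) 1) := by
    calc H = 1 * H := (one_mul _).symm
      _ ≤ (max (8 * d / Y) 4 * P) * H := by gcongr
      _ = max (8 * d / Y) 4 * (P * H) := by ring
      _ ≤ _ := by gcongr
  have hyg : 0 < y ^ (β / 2 - 1) := Real.rpow_pos_of_pos hy _
  have hs : 0 ≤ √(d * C₀) := Real.sqrt_nonneg _
  rcases le_total (8 * d / Y) 4 with hc | hc
  · rw [max_eq_right hc] at h4
    have h5 : max (y ^ (β - 1)) 1 ≤ y ^ (β / 2 - 1) + 1 := by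
      apply max_le _ (by linarith)
      rcases le_total y 1 with h | h
      · have := Real.rpow_le_rpow_of_exponent_ge hy h (show β / 2 - 1 ≤ β - 1 by linarith)
        linarith
      · have := Real.rpow_le_one_of_one_le_of_nonpos h (show β - 1 ≤ 0 by linarith)
        linarith
    calc H ≤ 8 * C₀ * max (y ^ (β - 1)) 1 := by linarith
      _ ≤ _ := by gcongr; linarith
  · rw [max_eq_left hc] at h4
    rcases le_total y 1 with h | h
    · have h6 : max (y ^ (β - 1)) 1 = y ^ (β - 1) :=
        max_eq_left (Real.one_le_rpow_of_pos_of_le_one_of_nonpos hy h (by linarith))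
      rw [h6] at h4
      have h7 : H * H ≤ (Y / y) * (8 * d / Y * (2 * C₀ * y ^ (β - 1))) := by gcongr
      have h8 : (Y / y) * (8 * d / Y * (2 * C₀ * y ^ (β - 1))) =
          (4 * √(d * C₀) * y ^ (β / 2 - 1)) ^ 2 := by
        rw [mul_pow, mul_pow, Real.sq_sqrt (by positivity), ← Real.rpow_natCast (y ^ (β / 2 - 1)),
          ← Real.rpow_mul hy.le]
        have : (β / 2 - 1) * ((2 : ℕ) : ℝ) = β - 1 - 1 := by push_cast; ring
        rw [this, Real.rpow_sub_one hy.ne' (β - 1)]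
        field_simp
        norm_num
      rw [h8, ← sq] at h7
      have h9 : H ≤ 4 * √(d * C₀) * y ^ (β / 2 - 1) := 
        (pow_le_pow_iff_left₀ hH (by positivity) two_ne_zero).1 h7
      refine h9.trans ?_
      gcongr <;> linarith
    · have h5 : Y ≤ 2 * d := by
        rw [le_div_iff₀ hY] at hc; linarith
      have h6 : Y / y ≤ 2 * d := by
        rw [div_le_iff₀ hy]; nlinarith
      nlinarith [mul_nonneg (show 0 ≤ 4 * √(d * C₀) + 8 * C₀ + 16 * d by positivity) hyg.le]


lemma hl_vert {h : ℂ → ℂ} {M γ : ℝ} (hM : 0 ≤ M) (hγ : 0 < γ) (hγ1 : γ ≤ 1)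
    (hh : DifferentiableOn ℂ h UHP)
    (hd : ∀ z ∈ UHP, ‖deriv h z‖ ≤ M * (z.im ^ (γ - 1) + 1)) {z : ℂ} (hz : z ∈ UHP) {r : ℝ}
    (hr : 0 < r) : ‖h (z + r * I) - h z‖ ≤ M * (r ^ γ / γ + r) := by
  have hy : 0 < z.im := hz
  have e : ∀ s : ℝ, (z.re : ℂ) + s * I = z + (s - z.im : ℝ) * I := by
    intro s
    apply Complex.ext <;> simp
  have hB : ∀ s ∈ Icc z.im (z.im + r), HasDerivAt
      (fun s : ℝ => M * ((s ^ γ - z.im ^ γ) / γ + (s - z.im))) (M * (s ^ (γ - 1) + 1)) s := by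
    intro s hs
    have hs0 : 0 < s := hy.trans_le hs.1
    have h1 := Real.hasDerivAt_rpow_const (x := s) (p := γ) (Or.inl hs0.ne')
    have h2 := (((h1.sub_const (z.im ^ γ)).div_const γ).add
      ((hasDerivAt_id s).sub_const z.im)).const_mul M
    refine HasDerivAt.congr_deriv h2 ?_
    field_simp
  have key := image_norm_le_of_norm_deriv_right_le_deriv_boundary'
    (f := fun s : ℝ => h ((z.re : ℂ) + s * I) - h z) (a := z.im) (b := z.im + r)
    (f' := fun s : ℝ => deriv h ((z.re : ℂ) + s * I) * I)
    (B := fun s : ℝ => M * ((s ^ γ - z.im ^ γ) / γ + (s - z.im)))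
    (B' := fun s : ℝ => M * (s ^ (γ - 1) + 1)) ?_ ?_ ?_ ?_ ?_ ?_
    (right_mem_Icc.2 (by linarith : z.im ≤ z.im + r))
  · have e2 := e (z.im + r)
    rw [show z.im + r - z.im = r by ring] at e2
    simp only [e2] at key
    refine key.trans ?_
    have := Real.rpow_add_le_add_rpow hy.le hr.le hγ.le hγ1
    gcongr
    · linarith
    · linarith
  · intro s hs
    exact ((vline_deriv hh z.re (hy.trans_le hs.1)).sub_const _).continuousAt.continuousWithinAt
  · intro s hs
    exact ((vline_deriv hh z.re (hy.trans_le hs.1)).sub_const _).hasDerivWithinAt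
  · have : (z.re : ℂ) + z.im * I = z := re_add_im z
    simp [this]
  · exact fun s hs => (hB s hs).continuousAt.continuousWithinAt
  · exact fun s hs => (hB s (Ico_subset_Icc_self hs)).hasDerivWithinAt
  · intro s hs
    have hs0 : 0 < s := hy.trans_le hs.1
    have h1 := hd _ (vline_mem z.re hs0)
    have him : ((z.re : ℂ) + s * I).im = s := by simp
    rw [him] at h1
    rwa [norm_mul, norm_I, mul_one]

lemma hl_horiz {h : ℂ → ℂ} {M γ : ℝ} (hM : 0 ≤ M) (hγ1 : γ ≤ 1)
    (hh : DifferentiableOn ℂ h UHP)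
    (hd : ∀ z ∈ UHP, ‖deriv h z‖ ≤ M * (z.im ^ (γ - 1) + 1)) {z w : ℂ} {r : ℝ}
    (hr : 0 < r) (hz : r ≤ z.im) (hw : r ≤ w.im) :
    ‖h w - h z‖ ≤ M * (r ^ (γ - 1) + 1) * ‖w - z‖ := by
  have hc : Convex ℝ {z : ℂ | r ≤ z.im} := convex_halfSpace_im_ge r
  refine hc.norm_image_sub_le_of_norm_deriv_le (fun u hu => ?_) (fun u hu => ?_) hz hw
  · have hu : r ≤ u.im := hu
    exact hh.differentiableAt (isOpen_UHP.mem_nhds (show 0 < u.im from hr.trans_le hu))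
  · have hu : r ≤ u.im := hu
    refine (hd u (show 0 < u.im from hr.trans_le hu)).trans ?_
    have := Real.rpow_le_rpow_of_nonpos hr hu (show γ - 1 ≤ 0 by linarith)
    gcongr

lemma hardy_littlewood {h : ℂ → ℂ} {M γ : ℝ} (hM : 0 ≤ M) (hγ : 0 < γ) (hγ1 : γ ≤ 1)
    (hh : DifferentiableOn ℂ h UHP)
    (hd : ∀ z ∈ UHP, ‖deriv h z‖ ≤ M * (z.im ^ (γ - 1) + 1)) :
    IsHolder h γ (M * (2 / γ + 4)) := by
  intro z hz w hw
  rcases eq_or_ne z w with rfl | hne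
  · simp only [dist_self]
    positivity
  have hr : 0 < dist z w := dist_pos.2 hne
  set r := dist z w with hrd
  have hz0 : 0 < z.im := hz
  have hw0 : 0 < w.im := hw
  have h1 := hl_vert hM hγ hγ1 hh hd hz hr
  have h2 := hl_vert hM hγ hγ1 hh hd hw hr
  have h3 := hl_horiz (z := z + r * I) (w := w + r * I) hM hγ1 hh hd hr (by simp; linarith)
    (by simp; linarith)
  have e : ‖w + r * I - (z + r * I)‖ = r := by
    rw [hrd, dist_comm, dist_eq_norm]; congr 1; ring
  rw [e, Real.rpow_sub_one hr.ne'] at h3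
  have e3 : M * (r ^ γ / r + 1) * r = M * (r ^ γ + r) := by field_simp
  rw [e3] at h3
  have e4 : h z - h w = -(h (z + r * I) - h z) + (-(h (w + r * I) - h (z + r * I)) +
    (h (w + r * I) - h w)) := by ring
  have h4 : dist (h z) (h w) ≤ ‖h (z + r * I) - h z‖ + (‖h (w + r * I) - h (z + r * I)‖ +
    ‖h (w + r * I) - h w‖) := by
    rw [dist_eq_norm, e4]
    refine (norm_add_le _ _).trans ?_
    rw [norm_neg]
    gcongr
    refine (norm_add_le _ _).trans ?_
    rw [norm_neg]
  set X := max (r ^ γ) r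
  have hX1 : r ^ γ ≤ X := le_max_left _ _
  have hX2 : r ≤ X := le_max_right _ _
  calc dist (h z) (h w) ≤ M * (r ^ γ / γ + r) + (M * (r ^ γ + r) + M * (r ^ γ / γ + r)) := by
        linarith
    _ ≤ M * (X / γ + X) + (M * (X + X) + M * (X / γ + X)) := by gcongr
    _ = M * (2 / γ + 4) * X := by ring

theorem holder_subinvariance (β C₀ d : ℝ) (hβ0 : 0 < β) (hβ1 : β ≤ 1)
    (hC₀ : 0 < C₀) :
    ∃ C > 0, ∀ (K K' : Set ℂ) (f g f' g' : ℂ → ℂ),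
      IsHull K → IsHull K' → K'.Nonempty → K' ⊆ K →
      Metric.diam K = d →
      IsHydroPair K f g → IsHydroPair K' f' g' →
      IsHolder f β C₀ →
      ∀ fh gh : ℂ → ℂ, IsHydroPair (g' '' (K \ K')) fh gh →
        IsHolder fh (β / 2) C := by
  refine ⟨(4 * √(|d| * C₀) + 8 * C₀ + 16 * |d|) * (2 / (β / 2) + 4), by positivity, ?_⟩
  intro K K' f g f' g' hK _ hne hsub hdiam hf hf' hol fh gh hfh
  have hK'd : ∀ w ∈ K', w.im ≤ d := fun w hw => hdiam ▸ hull_height hK (hsub hw)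
  have hd : 0 < d := by
    obtain ⟨w, hw⟩ := hne
    have h1 : 0 < w.im := hK.2.1 (hsub hw)
    exact h1.trans_le (hK'd w hw)
  rw [abs_of_pos hd]
  have heq := hydro_unique hβ0 hC₀ hol hf (hydro_comp hsub hK.2.1 hf' hfh.1)
  refine hardy_littlewood (by positivity) (by linarith) (by linarith) hfh.1.1 fun z hz => ?_
  exact main_deriv hd hK'd hβ0 hβ1 hC₀ hf' hol hf.1.1 hfh.1.1
    (fun w hw => (hydro_mapsTo hfh.1 hw).1) heq hz
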